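/- Let x, y ∈ (0,1] and let f : [0,1]^2 → ℝ be twice continuously differentiable. Define F_n f(x,y) := n · Σ_{k=0}^{n} Σ_{l=0}^{n} p_{n,k}(x) p_{n,l}(y) ( sqrt(l(l-1)/(n(n-1))) - l/n ) · ∂f/∂y (k/n, l/n). Then the limit as n → ∞ of F_n f(x,y) equals -((1-y)/2) · ∂f/∂y (x,y). -/

import Mathlib

open Filter Finset

/-- Bernstein basis polynomial `p_{n,k}(x) = C(n,k) x^k (1-x)^{n-k}`. -/
noncomputable def bern (n k : ℕ) (x : ℝ) : ℝ := (n.choose k : ℝ) * x ^ k * (1 - x) ^ (n - k)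

/-- The AKR node `t_{n,k} = √(k(k-1)/(n(n-1)))`. -/
noncomputable def akrNode (n k : ℕ) : ℝ := Real.sqrt ((k * (k - 1)) / (n * (n - 1)))

/-- The unit square `[0,1]²`. -/
def unitSquare : Set (ℝ × ℝ) := Set.Icc 0 1 ×ˢ Set.Icc 0 1

/-- Partial derivative in the first variable, taken within `[0,1]`. -/
noncomputable def pderivX (f : ℝ × ℝ → ℝ) (p : ℝ × ℝ) : ℝ :=
  derivWithin (fun s => f (s, p.2)) (Set.Icc 0 1) p.1

/-- Partial derivative in the second variable, taken within `[0,1]`. -/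
noncomputable def pderivY (f : ℝ × ℝ → ℝ) (p : ℝ × ℝ) : ℝ :=
  derivWithin (fun t => f (p.1, t)) (Set.Icc 0 1) p.2

/-- The bivariate tensor-product Bernstein operator
`B_n^{[2]} f(x,y) = Σ_{k=0}^n Σ_{l=0}^n f(k/n, l/n) p_{n,k}(x) p_{n,l}(y)`. -/
noncomputable def bernstein2Op (n : ℕ) (f : ℝ × ℝ → ℝ) (x y : ℝ) : ℝ :=
  ∑ k ∈ Finset.range (n + 1), ∑ l ∈ Finset.range (n + 1),
    f ((k : ℝ) / n, (l : ℝ) / n) * bern n k x * bern n l y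

/-- The bivariate Aldaz–Kounchev–Render operator with `j = 2`:
`B_{n,2}^{[2]} f(x,y) = Σ_{k=0}^n Σ_{l=0}^n f(t_{n,k}, t_{n,l}) p_{n,k}(x) p_{n,l}(y)`. -/
noncomputable def akr2Op (n : ℕ) (f : ℝ × ℝ → ℝ) (x y : ℝ) : ℝ :=
  ∑ k ∈ Finset.range (n + 1), ∑ l ∈ Finset.range (n + 1),
    f (akrNode n k, akrNode n l) * bern n k x * bern n l y

open scoped Topology

lemma bern_eq_eval (n k : ℕ) (x : ℝ) : bern n k x = (bernsteinPolynomial ℝ n k).eval x := by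
  simp [bern, bernsteinPolynomial]

lemma bern_nonneg (n k : ℕ) {x : ℝ} (hx : x ∈ Set.Icc (0 : ℝ) 1) : 0 ≤ bern n k x := by
  have h₀ := hx.1
  have h₁ : 0 ≤ 1 - x := sub_nonneg.2 hx.2
  unfold bern
  positivity

lemma sum_bern (n : ℕ) (x : ℝ) : ∑ k ∈ range (n + 1), bern n k x = 1 := by
  simpa [bern_eq_eval, Polynomial.eval_finsetSum] using
    congrArg (Polynomial.eval x) (bernsteinPolynomial.sum ℝ n)

lemma sum_bern_mul_sq (n : ℕ) (hn : n ≠ 0) (x : ℝ) :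
    ∑ k ∈ range (n + 1), bern n k x * ((k : ℝ) / n - x) ^ 2 = x * (1 - x) / n := by
  have h := congrArg (Polynomial.eval x) (bernsteinPolynomial.variance ℝ n)
  simp only [Polynomial.eval_finsetSum, Polynomial.eval_mul, Polynomial.eval_pow,
    Polynomial.eval_sub, nsmul_eq_mul, Polynomial.eval_natCast, Polynomial.eval_X,
    Polynomial.eval_one, ← bern_eq_eval] at h
  have hn' : (n : ℝ) ≠ 0 := by exact_mod_cast hn
  have key : ∀ k : ℕ, bern n k x * ((k : ℝ) / n - x) ^ 2 =
      ((n * x - k) ^ 2 * bern n k x) / (n : ℝ) ^ 2 := by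
    intro k
    field_simp
    ring
  simp only [key]
  rw [← Finset.sum_div, h]
  field_simp

/-- The filter of triples `(n, k, l)` with `k, l ≤ n`, `n → ∞` and `(k/n, l/n) → p`. -/
noncomputable def nodeFilter (p : ℝ × ℝ) : Filter (ℕ × ℕ × ℕ) :=
  comap (fun q => (q.1, ((q.2.1 : ℝ) / q.1, (q.2.2 : ℝ) / q.1))) (atTop ×ˢ 𝓝 p) ⊓
    𝓟 {q | q.2.1 ≤ q.1 ∧ q.2.2 ≤ q.1}

lemma tendsto_nodeFilter (p : ℝ × ℝ) :
    Tendsto (fun q : ℕ × ℕ × ℕ => (q.1, ((q.2.1 : ℝ) / q.1, (q.2.2 : ℝ) / q.1)))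
      (nodeFilter p) (atTop ×ˢ 𝓝 p) :=
  tendsto_comap.mono_left inf_le_left

lemma eventually_nodeFilter {p : ℝ × ℝ} {P : ℕ × ℕ × ℕ → Prop}
    (h : ∀ᶠ q in nodeFilter p, P q) :
    ∃ N : ℕ, ∃ δ > 0, ∀ n ≥ N, ∀ k ≤ n, ∀ l ≤ n,
      dist ((k : ℝ) / n, (l : ℝ) / n) p < δ → P (n, k, l) := by
  rw [nodeFilter, eventually_inf_principal] at h
  obtain ⟨⟨N, δ⟩, ⟨-, hδ⟩, H⟩ :=
    ((atTop_basis.prod (Metric.nhds_basis_ball (x := p))).comap _).eventually_iff.1 h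
  exact ⟨N, δ, hδ, fun n hn k hk l hl hd => @H (n, k, l) ⟨hn, hd⟩ ⟨hk, hl⟩⟩

/-- Bernstein averages of a uniformly bounded family converge to its limit at the base point. -/
lemma tendsto_sum_bern_mul {x y : ℝ} (hx : x ∈ Set.Icc (0 : ℝ) 1) (hy : y ∈ Set.Icc (0 : ℝ) 1)
    (h : ℕ → ℕ → ℕ → ℝ) (L M : ℝ)
    (hM : ∀ n ≥ 2, ∀ k ≤ n, ∀ l ≤ n, |h n k l| ≤ M)
    (hL : Tendsto (fun q : ℕ × ℕ × ℕ => h q.1 q.2.1 q.2.2) (nodeFilter (x, y)) (𝓝 L)) :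
    Tendsto (fun n : ℕ => ∑ k ∈ range (n + 1), ∑ l ∈ range (n + 1),
      bern n k x * bern n l y * h n k l) atTop (𝓝 L) := by
  rw [Metric.tendsto_nhds]
  intro ε hε
  obtain ⟨N, δ, hδ, H⟩ := eventually_nodeFilter (hL.eventually (Metric.ball_mem_nhds L (half_pos hε)))
  have hM₀ : 0 ≤ M := (abs_nonneg _).trans (hM 2 le_rfl 0 (by norm_num) 0 (by norm_num))
  set C : ℝ := (M + |L|) / δ ^ 2 with hC
  have hC₀ : 0 ≤ C := by positivity
  have hlim : Tendsto (fun n : ℕ => C * (x * (1 - x) + y * (1 - y)) / (n : ℝ)) atTop (𝓝 0) :=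
    tendsto_const_div_atTop_nhds_zero_nat _
  filter_upwards [eventually_ge_atTop N, eventually_ge_atTop 2,
    hlim.eventually (gt_mem_nhds (half_pos hε))] with n hnN hn2 hn
  have pointwise : ∀ k ∈ range (n + 1), ∀ l ∈ range (n + 1),
      |h n k l - L| ≤ ε / 2 + C * (((k : ℝ) / n - x) ^ 2 + ((l : ℝ) / n - y) ^ 2) := by
    intro k hk l hl
    have hk' : k ≤ n := by simpa [Nat.lt_succ_iff] using hk
    have hl' : l ≤ n := by simpa [Nat.lt_succ_iff] using hl
    by_cases hd : dist ((k : ℝ) / n, (l : ℝ) / n) (x, y) < δ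
    · have h₁ : |h n k l - L| < ε / 2 := H n hnN k hk' l hl' hd
      have : 0 ≤ C * (((k : ℝ) / n - x) ^ 2 + ((l : ℝ) / n - y) ^ 2) := by positivity
      linarith
    · have hsq : δ ^ 2 ≤ ((k : ℝ) / n - x) ^ 2 + ((l : ℝ) / n - y) ^ 2 := by
        rw [not_lt, Prod.dist_eq, le_max_iff, Real.dist_eq, Real.dist_eq] at hd
        rcases hd with hd | hd
        · have := pow_le_pow_left₀ hδ.le hd 2
          rw [sq_abs] at this
          nlinarith [sq_nonneg ((l : ℝ) / n - y)]
        · have := pow_le_pow_left₀ hδ.le hd 2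
          rw [sq_abs] at this
          nlinarith [sq_nonneg ((k : ℝ) / n - x)]
      have h₁ : |h n k l - L| ≤ M + |L| :=
        (abs_sub _ _).trans (add_le_add_left (hM n hn2 k hk' l hl') _)
      have h₂ : M + |L| = C * δ ^ 2 := by
        rw [hC]
        field_simp
      have := mul_le_mul_of_nonneg_left hsq hC₀
      linarith
  have hn0 : n ≠ 0 := by omega
  have hmass : ∑ k ∈ range (n + 1), ∑ l ∈ range (n + 1), bern n k x * bern n l y = 1 := by
    rw [← Finset.sum_mul_sum, sum_bern, sum_bern, one_mul]
  have hmom : ∑ k ∈ range (n + 1), ∑ l ∈ range (n + 1), bern n k x * bern n l y *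
      (((k : ℝ) / n - x) ^ 2 + ((l : ℝ) / n - y) ^ 2) =
      (x * (1 - x) + y * (1 - y)) / n := by
    calc _ = ∑ k ∈ range (n + 1), ∑ l ∈ range (n + 1),
          ((bern n k x * ((k : ℝ) / n - x) ^ 2) * bern n l y +
            bern n k x * (bern n l y * ((l : ℝ) / n - y) ^ 2)) :=
          Finset.sum_congr rfl fun k _ => Finset.sum_congr rfl fun l _ => by ring
      _ = _ := by
          simp only [Finset.sum_add_distrib]
          rw [← Finset.sum_mul_sum, ← Finset.sum_mul_sum, sum_bern, sum_bern,
            sum_bern_mul_sq n hn0, sum_bern_mul_sq n hn0]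
          ring
  have hdiff : ∑ k ∈ range (n + 1), ∑ l ∈ range (n + 1), bern n k x * bern n l y * h n k l - L =
      ∑ k ∈ range (n + 1), ∑ l ∈ range (n + 1), bern n k x * bern n l y * (h n k l - L) := by
    simp only [mul_sub, Finset.sum_sub_distrib, ← Finset.sum_mul, hmass, one_mul]
  rw [Real.dist_eq, hdiff]
  calc _ ≤ ∑ k ∈ range (n + 1), ∑ l ∈ range (n + 1), bern n k x * bern n l y *
        (ε / 2 + C * (((k : ℝ) / n - x) ^ 2 + ((l : ℝ) / n - y) ^ 2)) := by
        refine (Finset.abs_sum_le_sum_abs _ _).trans (Finset.sum_le_sum fun k hk => ?_)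
        refine (Finset.abs_sum_le_sum_abs _ _).trans (Finset.sum_le_sum fun l hl => ?_)
        have hw := mul_nonneg (bern_nonneg n k hx) (bern_nonneg n l hy)
        rw [abs_mul, abs_of_nonneg hw]
        exact mul_le_mul_of_nonneg_left (pointwise k hk l hl) hw
    _ = ε / 2 + C * (x * (1 - x) + y * (1 - y)) / n := by
        simp only [mul_add (bern _ _ _ * bern _ _ _) (ε / 2), Finset.sum_add_distrib,
          ← Finset.sum_mul, mul_left_comm _ C, ← Finset.mul_sum, hmom, sum_bern]
        ring
    _ < ε := by linarith

lemma hasDerivWithinAt_snd {f : ℝ × ℝ → ℝ} (hf : DifferentiableOn ℝ f unitSquare)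
    {p : ℝ × ℝ} (hp : p ∈ unitSquare) :
    HasDerivWithinAt (fun t => f (p.1, t)) (fderivWithin ℝ f unitSquare p (0, 1))
      (Set.Icc 0 1) p.2 := by
  have h₁ : HasDerivWithinAt (fun t : ℝ => (p.1, t)) ((0 : ℝ), (1 : ℝ)) (Set.Icc 0 1) p.2 :=
    (hasDerivWithinAt_const p.2 _ p.1).prodMk (hasDerivWithinAt_id p.2 _)
  have hmaps : Set.MapsTo (fun t : ℝ => (p.1, t)) (Set.Icc 0 1) unitSquare :=
    fun t ht => ⟨hp.1, ht⟩
  exact (hf p hp).hasFDerivWithinAt.comp_hasDerivWithinAt p.2 h₁ hmaps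

lemma continuousOn_pderivY {f : ℝ × ℝ → ℝ} (hf : ContDiffOn ℝ 1 f unitSquare) :
    ContinuousOn (pderivY f) unitSquare := by
  have hI : UniqueDiffOn ℝ (Set.Icc (0 : ℝ) 1) := uniqueDiffOn_Icc zero_lt_one
  have hu : UniqueDiffOn ℝ unitSquare := hI.prod hI
  refine ((hf.continuousOn_fderivWithin hu le_rfl).clm_apply
    (continuousOn_const (c := ((0 : ℝ), (1 : ℝ))))).congr fun p hp => ?_
  exact (hasDerivWithinAt_snd (hf.differentiableOn one_ne_zero) hp).derivWithin (hI _ hp.2)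

/-- The scaled deviation of the node `t_{n,l}` from `l/n`, with the square root rationalised. -/
lemma mul_akrNode_sub {n l : ℕ} (hn : 2 ≤ n) (hl : 0 < l) :
    (n : ℝ) * (akrNode n l - (l : ℝ) / n) =
      -((1 - (l : ℝ) / n) / (1 - 1 / n)) * ((l : ℝ) / n / (akrNode n l + (l : ℝ) / n)) := by
  have hn' : (2 : ℝ) ≤ n := by exact_mod_cast hn
  have hl' : (1 : ℝ) ≤ l := by exact_mod_cast hl
  have hn1 : (0 : ℝ) < n - 1 := by linarith
  have ht : 0 ≤ akrNode n l := Real.sqrt_nonneg _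
  have hsq : akrNode n l ^ 2 = (l * (l - 1)) / (n * (n - 1)) :=
    Real.sq_sqrt (div_nonneg (mul_nonneg (by linarith) (by linarith)) (by positivity))
  have hs : (0 : ℝ) < (l : ℝ) / n := by positivity
  have hsum : akrNode n l + (l : ℝ) / n ≠ 0 := by positivity
  have key : (akrNode n l - (l : ℝ) / n) * (akrNode n l + (l : ℝ) / n) =
      -((1 - (l : ℝ) / n) / (n - 1)) * ((l : ℝ) / n) := by
    have : (akrNode n l - (l : ℝ) / n) * (akrNode n l + (l : ℝ) / n) =
      akrNode n l ^ 2 - ((l : ℝ) / n) ^ 2 := by ring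
    rw [this, hsq]
    field_simp
    ring
  have hn2 : (1 : ℝ) - 1 / n = (n - 1) / n := by field_simp
  rw [eq_div_of_mul_eq hsum key, hn2]
  field_simp

lemma abs_mul_akrNode_sub_le {n l : ℕ} (hn : 2 ≤ n) (hl : l ≤ n) :
    |(n : ℝ) * (akrNode n l - (l : ℝ) / n)| ≤ 1 := by
  rcases Nat.eq_zero_or_pos l with rfl | hl0
  · simp [akrNode]
  have hn' : (2 : ℝ) ≤ n := by exact_mod_cast hn
  have hl1 : (1 : ℝ) ≤ l := by exact_mod_cast hl0
  have hln : (l : ℝ) ≤ n := by exact_mod_cast hl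
  have ht : 0 ≤ akrNode n l := Real.sqrt_nonneg _
  have hs : (0 : ℝ) < (l : ℝ) / n := by positivity
  have hs1 : 1 / (n : ℝ) ≤ (l : ℝ) / n := by gcongr
  have hs2 : (l : ℝ) / n ≤ 1 := (div_le_one (by linarith)).2 hln
  have hn1 : 1 / (n : ℝ) < 1 := (div_lt_one (by linarith)).2 (by linarith)
  rw [mul_akrNode_sub hn hl0, abs_mul, abs_neg, abs_of_nonneg (div_nonneg (by linarith) (by linarith)),
    abs_of_nonneg (by positivity)]
  exact mul_le_one₀ ((div_le_one (by linarith)).2 (by linarith)) (by positivity)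
    ((div_le_one (by positivity)).2 (by linarith))

lemma tendsto_mul_akrNode_sub {p : ℝ × ℝ} (hp : 0 < p.2) :
    Tendsto (fun q : ℕ × ℕ × ℕ => (q.1 : ℝ) * (akrNode q.1 q.2.2 - (q.2.2 : ℝ) / q.1))
      (nodeFilter p) (𝓝 (-((1 - p.2) / 2))) := by
  have hn : Tendsto (fun q : ℕ × ℕ × ℕ => q.1) (nodeFilter p) atTop :=
    (tendsto_nodeFilter p).fst
  have hs : Tendsto (fun q : ℕ × ℕ × ℕ => (q.2.2 : ℝ) / q.1) (nodeFilter p) (𝓝 p.2) :=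
    (continuous_snd.tendsto p).comp (tendsto_nodeFilter p).snd
  have hi : Tendsto (fun q : ℕ × ℕ × ℕ => 1 / (q.1 : ℝ)) (nodeFilter p) (𝓝 0) :=
    tendsto_one_div_atTop_nhds_zero_nat.comp hn
  have hd : Tendsto (fun q : ℕ × ℕ × ℕ => 1 - 1 / (q.1 : ℝ)) (nodeFilter p) (𝓝 1) := by
    simpa using hi.const_sub 1
  have ht : Tendsto (fun q : ℕ × ℕ × ℕ => akrNode q.1 q.2.2) (nodeFilter p) (𝓝 p.2) := by
    have h₁ := (hs.mul ((hs.sub hi).div hd one_ne_zero)).sqrt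
    rw [sub_zero, div_one, Real.sqrt_mul_self hp.le] at h₁
    refine h₁.congr' ?_
    filter_upwards [hn.eventually_ge_atTop 2] with q hq
    have hq' : (2 : ℝ) ≤ q.1 := by exact_mod_cast hq
    have : (q.1 : ℝ) - 1 ≠ 0 := by linarith
    have h₂ : (1 : ℝ) - 1 / q.1 = (q.1 - 1) / q.1 := by field_simp
    rw [akrNode, Pi.div_apply, h₂]
    congr 1
    field_simp
  have hlim := ((hs.const_sub 1).div hd one_ne_zero).neg.mul
    (hs.div (ht.add hs) (by positivity))
  have hval : -((1 - p.2) / 1) * (p.2 / (p.2 + p.2)) = -((1 - p.2) / 2) := by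
    field_simp
    ring
  rw [hval] at hlim
  refine hlim.congr' ?_
  filter_upwards [hn.eventually_ge_atTop 2, hs.eventually (lt_mem_nhds hp)] with q hq hq0
  have hl : 0 < q.2.2 := by
    rcases Nat.eq_zero_or_pos q.2.2 with h | h
    · simp [h] at hq0
    · exact h
  exact (mul_akrNode_sub hq hl).symm

lemma div_mem_Icc {n k : ℕ} (hk : k ≤ n) : (k : ℝ) / n ∈ Set.Icc (0 : ℝ) 1 :=
  ⟨by positivity, div_le_one_of_le₀ (by exact_mod_cast hk) (by positivity)⟩

theorem stmt_10 (x y : ℝ) (hx : x ∈ Set.Ioc (0 : ℝ) 1) (hy : y ∈ Set.Ioc (0 : ℝ) 1)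
    (f : ℝ × ℝ → ℝ) (hf : ContDiffOn ℝ 2 f unitSquare) :
    Tendsto (fun n : ℕ => (n : ℝ) * ∑ k ∈ Finset.range (n + 1), ∑ l ∈ Finset.range (n + 1),
        bern n k x * bern n l y * (akrNode n l - (l : ℝ) / n) * pderivY f ((k : ℝ) / n, (l : ℝ) / n))
      atTop (nhds (-((1 - y) / 2) * pderivY f (x, y))) := by
  have hx' := Set.Ioc_subset_Icc_self hx
  have hy' := Set.Ioc_subset_Icc_self hy
  have hg : ContinuousOn (pderivY f) unitSquare :=
    continuousOn_pderivY (hf.of_le one_le_two)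
  obtain ⟨M, hM⟩ := (isCompact_Icc.prod isCompact_Icc : IsCompact unitSquare)
    |>.exists_bound_of_continuousOn hg
  have hnodes : Tendsto (fun q : ℕ × ℕ × ℕ => ((q.2.1 : ℝ) / q.1, (q.2.2 : ℝ) / q.1))
      (nodeFilter (x, y)) (𝓝[unitSquare] (x, y)) := by
    refine tendsto_nhdsWithin_iff.2 ⟨(tendsto_nodeFilter (x, y)).snd, ?_⟩
    exact eventually_inf_principal.2 <| Eventually.of_forall fun q hq =>
      ⟨div_mem_Icc hq.1, div_mem_Icc hq.2⟩
  have hlim := (tendsto_mul_akrNode_sub (p := (x, y)) hy.1).mul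
    ((hg (x, y) ⟨hx', hy'⟩).tendsto.comp hnodes)
  refine (tendsto_sum_bern_mul hx' hy'
    (fun n k l => (n : ℝ) * (akrNode n l - (l : ℝ) / n) * pderivY f ((k : ℝ) / n, (l : ℝ) / n))
    _ M (fun n hn k hk l hl => ?_) hlim).congr fun n => ?_
  · have hb := hM ((k : ℝ) / n, (l : ℝ) / n) ⟨div_mem_Icc hk, div_mem_Icc hl⟩
    rw [Real.norm_eq_abs] at hb
    rw [abs_mul]
    exact (mul_le_of_le_one_left (abs_nonneg _) (abs_mul_akrNode_sub_le hn hl)).trans hb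
  · simp only [Finset.mul_sum]
    exact Finset.sum_congr rfl fun k _ => Finset.sum_congr rfl fun l _ => by ring
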